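/- If f(𝐱) = F₁(𝐱') + ωF₂(𝐱') ∈ 𝒢𝒮¹(Ω_D) is monogenic on Ω_D, then for every point 𝐱' = (𝐱_p, 0) ∈ D one has D_{𝐱_p}F₁(𝐱_p, 0) − q ∂_r F₂(𝐱_p, 0) = 0 and \overline{D}_{𝐱_p}F₂(𝐱_p, 0) + ∂_r F₁(𝐱_p, 0) = 0. -/

import Mathlib

/-!
Common framework for generalized partial-slice monogenic functions
(Xu–Sabadini, "On the Fueter-Sce theorem for generalized partial-slice
monogenic functions").

The real Clifford algebra `ℝ_{p+q}` is formalized as the Mathlib Clifford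
algebra of the negative-definite quadratic form on `ℝ^{p+q}`; since Mathlib
provides no canonical norm on it, all analytic statements are phrased for an
arbitrary normed real algebra `A` together with an `ℝ`-algebra isomorphism
`ξ : A ≃ₐ[ℝ] Cl (p+q)`.  A point of `ℝ^{p+q+1}` is a pair
`(𝐱_p, 𝐱_q) : (Fin (p+1) → ℝ) × EuclideanSpace ℝ (Fin q)`, and a point of a
slice `ℝ^{p+2}` is a pair `(𝐱_p, r)`.
-/

noncomputable section

open Filter Topology MeasureTheory Metric
open scoped Nat RealInnerProductSpace

namespace GPS

/-- The negative definite quadratic form `-(x₁² + ⋯ + xₙ²)` on `ℝⁿ`. -/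
def Qe (n : ℕ) : QuadraticForm ℝ (Fin n → ℝ) :=
  QuadraticMap.weightedSumSquares ℝ (fun _ : Fin n => (-1 : ℝ))

/-- The real Clifford algebra `ℝ_n`. -/
abbrev Cl (n : ℕ) : Type := CliffordAlgebra (Qe n)

/-- The generators `e_1, …, e_n` of `ℝ_n` (indexed by `Fin n`). -/
def e (n : ℕ) (i : Fin n) : Cl n := CliffordAlgebra.ι (Qe n) (Pi.single i 1)

variable (p q : ℕ)

/-- `ℝ^{p+1}`, the "slice-axis" space. -/
abbrev Vp : Type := Fin (p + 1) → ℝ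

/-- `ℝ^q`. -/
abbrev Vq : Type := EuclideanSpace ℝ (Fin q)

/-- `ℝ^{p+q+1} = ℝ^{p+1} ⊕ ℝ^q`. -/
abbrev V : Type := Vp p × Vq q

/-- `ℝ^{p+2}`, the parameter space `(𝐱_p, r)` of a slice. -/
abbrev Sl : Type := Vp p × ℝ

/-- The sphere `𝕊` of unit 1-vectors, described by their coordinate vectors
`(x_{p+1}, …, x_{p+q}) ∈ ℝ^q` with `∑ x_i² = 1`. -/
def S : Set (Vq q) := {v | ∑ j, v j ^ 2 = 1}

/-- The point `𝐱_p + r ω` of `ℝ^{p+q+1}`. -/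
def spt (v : Vq q) (z : Sl p) : V p q := (z.1, z.2 • v)

/-- The (parameterized) slice `Ω_ω` of a set `Ω ⊆ ℝ^{p+q+1}`. -/
def sliceSet (Ω : Set (V p q)) (v : Vq q) : Set (Sl p) := {z | spt p q v z ∈ Ω}

/-- `Ω₀* = {𝐱_p + 𝐱_q : 𝐱_p ∈ Ω₀, 𝐱_q ∈ ℝ^q}`. -/
def star0 (Ω₀ : Set (Vp p)) : Set (V p q) := {z | z.1 ∈ Ω₀}

/-- The p-symmetric completion `Ω_D` of a set `D ⊆ ℝ^{p+2}`. -/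
def completion (D : Set (Sl p)) : Set (V p q) :=
  {x | ∃ z ∈ D, ∃ v ∈ S q, x = spt p q v z}

/-- `D` is invariant under the reflection of the `(p+2)`-th variable. -/
def ReflInv (D : Set (Sl p)) : Prop := ∀ z ∈ D, ((z.1, -z.2) : Sl p) ∈ D

/-- A domain: a nonempty open connected set. -/
def IsDomain {E : Type*} [TopologicalSpace E] (s : Set E) : Prop :=
  IsOpen s ∧ IsConnected s

/-- A slice domain. -/
def IsSliceDomain (Ω : Set (V p q)) : Prop :=
  IsDomain Ω ∧ (∃ x : Vp p, ((x, 0) : V p q) ∈ Ω) ∧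
    ∀ v ∈ S q, IsDomain (sliceSet p q Ω v)

/-- Partial symmetry with respect to `ℝ^{p+1}`. -/
def IsPSymmetric (Ω : Set (V p q)) : Prop :=
  ∀ (x : Vp p) (r : ℝ), ∀ v ∈ S q, ∀ w ∈ S q,
    ((x, r • v) : V p q) ∈ Ω → ((x, r • w) : V p q) ∈ Ω

/-- A `d`-dimensional smooth submanifold of a real normed space. -/
def IsSmoothSubmanifoldDim {E : Type*} [NormedAddCommGroup E] [NormedSpace ℝ E]
    (d : ℕ) (M : Set E) : Prop :=
  ∀ x ∈ M, ∃ U : Set E, IsOpen U ∧ x ∈ U ∧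
    ∃ (ψ : (Fin d → ℝ) → E) (W : Set (Fin d → ℝ)), IsOpen W ∧
      ContDiffOn ℝ (⊤ : ℕ∞) ψ W ∧ Set.InjOn ψ W ∧
      (∀ y ∈ W, Function.Injective (fderivWithin ℝ ψ W y)) ∧
      M ∩ U = ψ '' W

variable {A : Type*} [NormedRing A] [NormedAlgebra ℝ A] (ξ : A ≃ₐ[ℝ] Cl (p + q))

/-- The generators `e_1, …, e_{p+q}` inside `A`. -/
def gen (i : Fin (p + q)) : A := ξ.symm (e (p + q) i)

/-- The generators `e_{p+1}, …, e_{p+q}` (the "q-part"). -/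
def eQ (j : Fin q) : A := gen p q ξ ⟨p + (j : ℕ), by have := j.isLt; omega⟩

/-- The generators `e_1, …, e_p` (the "p-part", without `e_0 = 1`). -/
def eP (i : Fin p) : A := gen p q ξ ⟨(i : ℕ), by have := i.isLt; omega⟩

/-- `e_0 = 1, e_1, …, e_p`: the paravector basis of `ℝ^{p+1}` inside `A`. -/
def εp (i : Fin (p + 1)) : A :=
  if h : (i : ℕ) = 0 then 1 else gen p q ξ ⟨(i : ℕ) - 1, by have := i.isLt; omega⟩

/-- The 1-vector `∑ x_i e_{p+i} ∈ A` corresponding to `𝐱_q ∈ ℝ^q`;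
for a unit `v` this is the imaginary unit `ω ∈ 𝕊`. -/
def ωCl (v : Vq q) : A := ∑ j, v j • eQ p q ξ j

/-- The paravector `x_0 + x_1 e_1 + ⋯ + x_p e_p ∈ A` of `𝐱_p ∈ ℝ^{p+1}`. -/
def clP (x : Vp p) : A := ∑ i, x i • εp p q ξ i

/-- The paravector of `𝐱 ∈ ℝ^{p+q+1}` in `A`. -/
def toCl (z : V p q) : A := clP p q ξ z.1 + ωCl p q ξ z.2

section SliceOperators

variable {F' : Type*} [NormedAddCommGroup F'] [NormedSpace ℝ F']

/-- `∂_{x_i}` on functions on `ℝ^{p+2}`. -/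
def pdSl (i : Fin (p + 1)) (F : Sl p → F') : Sl p → F' :=
  fun z => fderiv ℝ F z (Pi.single i 1, 0)

/-- `∂_r` on functions on `ℝ^{p+2}`. -/
def pdr (F : Sl p → F') : Sl p → F' := fun z => fderiv ℝ F z (0, 1)

/-- `∂_{x_i}` (first factor) on functions on `ℝ^{p+q+1}`. -/
def pdV1 (i : Fin (p + 1)) (f : V p q → F') : V p q → F' :=
  fun z => fderiv ℝ f z ((Pi.single i 1 : Vp p), 0)

/-- `∂_{x_{p+j}}` (second factor) on functions on `ℝ^{p+q+1}`. -/
def pdV2 (j : Fin q) (f : V p q → F') : V p q → F' :=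
  fun z => fderiv ℝ f z (0, EuclideanSpace.single j 1)

/-- `∂_{x_i}` on functions on `ℝ^{p+1}`. -/
def pdP (i : Fin (p + 1)) (g : Vp p → F') : Vp p → F' :=
  fun x => fderiv ℝ g x (Pi.single i 1)

/-- The Laplacian `Δ_{𝐱'} = Δ_{𝐱_p} + ∂_r²` on `ℝ^{p+2}`. -/
def LapSl (F : Sl p → F') : Sl p → F' :=
  fun z => ∑ i, pdSl p (i := i) (pdSl p i F) z + pdr p (pdr p F) z

/-- The Laplacian `Δ_𝐱` on `ℝ^{p+q+1}`. -/
def LapV (f : V p q → F') : V p q → F' :=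
  fun z => ∑ i, pdV1 p q i (pdV1 p q i f) z + ∑ j, pdV2 p q j (pdV2 p q j f) z

/-- The Laplacian `Δ_{𝐱_p}` on `ℝ^{p+1}`. -/
def LapP (g : Vp p → F') : Vp p → F' :=
  fun x => ∑ i, pdP p i (pdP p i g) x

end SliceOperators

/-- The generalized Cauchy–Riemann operator `D_{𝐱_p} = ∑_{i=0}^p e_i ∂_{x_i}`
on slice functions. -/
def DP (F : Sl p → A) : Sl p → A :=
  fun z => ∑ i, εp p q ξ i * pdSl p i F z

/-- The conjugated operator `D̄_{𝐱_p} = ∂_{x_0} - ∑_{i=1}^p e_i ∂_{x_i}`. -/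
def DPbar (F : Sl p → A) : Sl p → A :=
  fun z => pdSl p 0 F z - ∑ i : Fin p, eP p q ξ i * pdSl p i.succ F z

/-- The generalized Cauchy–Riemann (Dirac) operator `D_𝐱` on `ℝ^{p+q+1}`. -/
def DV (f : V p q → A) : V p q → A :=
  fun z => ∑ i, εp p q ξ i * pdV1 p q i f z + ∑ j, eQ p q ξ j * pdV2 p q j f z

/-- `D_{𝐱_p} = ∑_{i=0}^p e_i ∂_{x_i}` on functions on `ℝ^{p+1}`. -/
def DPfun (g : Vp p → A) : Vp p → A :=
  fun x => ∑ i, εp p q ξ i * pdP p i g x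

/-- The slice operator `D_ω = D_{𝐱_p} + ω ∂_r`, expressed on `ℝ^{p+q+1} ∖ ℝ^{p+1}`
(at `𝐱_q = 0` the radial part is junk `0`). -/
def Dslice (f : V p q → A) : V p q → A :=
  fun z => ∑ i, εp p q ξ i * pdV1 p q i f z
    + ωCl p q ξ (‖z.2‖⁻¹ • z.2) * fderiv ℝ f z (0, ‖z.2‖⁻¹ • z.2)

/-- The spherical Dirac operator `Γ = -∑_{i<j} e_i e_j L_{ij}` on the `ℝ^q` variables. -/
def sphericalDirac (f : V p q → A) : V p q → A :=
  fun z => - ∑ i : Fin q, ∑ j : Fin q,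
    if (i : ℕ) < (j : ℕ) then
      eQ p q ξ i * eQ p q ξ j *
        (z.2 i • pdV2 p q j f z - z.2 j • pdV2 p q i f z)
    else 0

/-- `f` is left generalized partial-slice monogenic of type `(p,q)` on `Ω`. -/
def GSMOn (Ω : Set (V p q)) (f : V p q → A) : Prop :=
  ∀ v ∈ S q,
    ContDiffOn ℝ 1 (fun z => f (spt p q v z)) (sliceSet p q Ω v) ∧
    ∀ z ∈ sliceSet p q Ω v,
      DP p q ξ (fun w => f (spt p q v w)) z
        + ωCl p q ξ v * pdr p (fun w => f (spt p q v w)) z = 0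

/-- `f` is (left) monogenic on `Ω`. -/
def MonogenicOn (Ω : Set (V p q)) (f : V p q → A) : Prop :=
  ContDiffOn ℝ 1 f Ω ∧ ∀ z ∈ Ω, DV p q ξ f z = 0

/-- `f` is the generalized partial-slice function on `Ω_D` with components `F1, F2`
(an even–odd pair in the last variable). -/
def IsGPSlice (D : Set (Sl p)) (f : V p q → A) (F1 F2 : Sl p → A) : Prop :=
  (∀ z ∈ D, F1 (z.1, -z.2) = F1 z ∧ F2 (z.1, -z.2) = -F2 z) ∧
  ∀ z ∈ D, ∀ v ∈ S q, f (spt p q v z) = F1 z + ωCl p q ξ v * F2 z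

/-- The generalized Cauchy–Riemann system (2.6) for the pair `(F1, F2)`. -/
def CRSystem (D : Set (Sl p)) (F1 F2 : Sl p → A) : Prop :=
  ∀ z ∈ D, DP p q ξ F1 z - pdr p F2 z = 0 ∧ DPbar p q ξ F2 z + pdr p F1 z = 0

/-- `f ∈ 𝒢𝒮ℛ(Ω_D)` with the given components. -/
def GSROnWith (D : Set (Sl p)) (f : V p q → A) (F1 F2 : Sl p → A) : Prop :=
  IsGPSlice p q ξ D f F1 F2 ∧ ContDiffOn ℝ 1 F1 D ∧ ContDiffOn ℝ 1 F2 D ∧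
    CRSystem p q ξ D F1 F2

/-- `f ∈ 𝒢𝒮ℛ(Ω_D)`. -/
def GSROn (D : Set (Sl p)) (f : V p q → A) : Prop :=
  ∃ F1 F2, GSROnWith p q ξ D f F1 F2

/-- Iterates `((1/r) ∂_r)^k F`. -/
def AIter (F : Sl p → A) : ℕ → Sl p → A
  | 0 => F
  | k + 1 => fun z => z.2⁻¹ • pdr p (AIter F k) z

/-- Iterates `(∂_r (1/r))^k F`. -/
def BIter (F : Sl p → A) : ℕ → Sl p → A
  | 0 => F
  | k + 1 => fun z => fderiv ℝ (fun w : Sl p => w.2⁻¹ • BIter F k w) z (0, 1)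

/-- `C_q(k) = (q-1)(q-3)⋯(q-2k+1)`. -/
def Cq (k : ℕ) : ℝ := ∏ j ∈ Finset.range k, ((q : ℝ) - (2 * (j : ℝ) + 1))

/-- The Fueter–Sce map `τ_q = (1/(q-1)!!) Δ^{(q-1)/2}` (for odd `q`). -/
def tauq (f : V p q → A) : V p q → A :=
  fun z => (((q - 1)‼ : ℝ))⁻¹ • (LapV p q)^[(q - 1) / 2] f z

/-- `(𝐱_q D_{𝐱_p})^k`, for a fixed Clifford element `u` in place of `𝐱_q`. -/
def uDpow (u : A) : ℕ → (Vp p → A) → Vp p → A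
  | 0 => fun g => g
  | k + 1 => fun g x => u * DPfun p q ξ (uDpow u k g) x

/-- The `k`-th term of the slice Cauchy–Kovalevskaya extension series. -/
def ckTerm (f₀ : Vp p → A) (k : ℕ) (z : V p q) : A :=
  ((k ! : ℝ))⁻¹ • uDpow p q ξ (ωCl p q ξ z.2) k f₀ z.1

/-- The slice Cauchy–Kovalevskaya extension `CK[f₀]`. -/
def CKext (f₀ : Vp p → A) (z : V p q) : A := ∑' k, ckTerm p q ξ f₀ k z

/-- The `k`-th term of the CK-extension for a fixed direction `w`. -/
def ckDirTerm (w : Vq q) (f₀ : Vp p → A) (k : ℕ) (z : V p q) : A :=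
  ((⟪w, z.2⟫) ^ k / (k ! : ℝ)) • uDpow p q ξ (ωCl p q ξ w) k f₀ z.1

/-- The CK-extension for a fixed direction `w ∈ 𝕊`. -/
def CKdir (w : Vq q) (f₀ : Vp p → A) (z : V p q) : A :=
  ∑' k, ckDirTerm p q ξ w f₀ k z

/-- The coefficients of the generalized CK-extension:
`f_{2k} = (Γ(q/2) / (2^{2k} k! Γ(k+q/2))) Δ^k f₀` and
`f_{2k+1} = (Γ(q/2) / (2^{2k+1} k! Γ(k+q/2+1))) D Δ^k f₀`. -/
def gckCoeff (f₀ : Vp p → A) (k : ℕ) : Vp p → A :=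
  if k % 2 = 0 then
    fun x => (Real.Gamma ((q : ℝ) / 2) /
        (2 ^ k * ((k / 2)! : ℝ) * Real.Gamma (((k / 2 : ℕ) : ℝ) + (q : ℝ) / 2))) •
      (LapP p)^[k / 2] f₀ x
  else
    fun x => (Real.Gamma ((q : ℝ) / 2) /
        (2 ^ k * ((k / 2)! : ℝ) * Real.Gamma (((k / 2 : ℕ) : ℝ) + (q : ℝ) / 2 + 1))) •
      DPfun p q ξ ((LapP p)^[k / 2] f₀) x

/-- The `k`-th term `𝐱_q^k f_k(𝐱_p)` of the generalized CK-extension series. -/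
def gckTerm (f₀ : Vp p → A) (k : ℕ) (z : V p q) : A :=
  (ωCl p q ξ z.2) ^ k * gckCoeff p q ξ f₀ k z.1

/-- The generalized CK-extension `GCK[f₀]`. -/
def GCKext (f₀ : Vp p → A) (z : V p q) : A := ∑' k, gckTerm p q ξ f₀ k z

/-- The Radon transform `R[f](𝐱_p, r, ω) = ∫_{⟨𝐱_q,ω⟩=r} f(𝐱_p, 𝐱_q) dσ(𝐱_q)`. -/
def radon (f : V p q → A) (x : Vp p) (r : ℝ) (w : Vq q) : A :=
  ∫ u : ((Submodule.span ℝ {w})ᗮ : Submodule ℝ (Vq q)),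
    f (x, r • w + (u : Vq q))

/-- The (suitably normalized) surface measure on the unit sphere of `ℝ^q`. -/
def sphMeasure : Measure (sphere (0 : Vq q) 1) := volume.toSphere

/-- The dual Radon transform
`Ř[f](𝐱_p, 𝐱_q) = (1/A_q) ∫_𝕊 f(𝐱_p, ⟨𝐱_q, η⟩ η) dS(η)` (a spherical average). -/
def dualRadon (f : V p q → A) (z : V p q) : A :=
  ⨍ w : sphere (0 : Vq q) 1,
    f (z.1, (⟪((w : Vq q)), z.2⟫) • (w : Vq q)) ∂(sphMeasure q)

end GPS

namespace GPS

/-- The reflection `(𝐱_p, r) ↦ (𝐱_p, -r)` as a continuous linear map. -/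
def reflCLM (p : ℕ) : Sl p →L[ℝ] Sl p :=
  (ContinuousLinearMap.fst ℝ (Vp p) ℝ).prod (-ContinuousLinearMap.snd ℝ (Vp p) ℝ)

/-- The map `(𝐱_p, r) ↦ 𝐱_p + r ω` as a continuous linear map. -/
def sptCLM (p q : ℕ) (v : Vq q) : Sl p →L[ℝ] V p q :=
  (ContinuousLinearMap.fst ℝ (Vp p) ℝ).prod
    ((ContinuousLinearMap.snd ℝ (Vp p) ℝ).smulRight v)

lemma reflCLM_apply (p : ℕ) (z : Sl p) : reflCLM p z = (z.1, -z.2) := rfl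

lemma mem_S_iff_norm_eq_one {q : ℕ} {v : Vq q} : v ∈ S q ↔ ‖v‖ = 1 := by
  change ∑ j, v j ^ 2 = 1 ↔ _
  rw [← EuclideanSpace.real_norm_sq_eq, pow_eq_one_iff_of_nonneg (norm_nonneg v) two_ne_zero]

lemma single_mem_S {q : ℕ} (j : Fin q) : EuclideanSpace.single j (1 : ℝ) ∈ S q := by
  simp [mem_S_iff_norm_eq_one]

/-- The completion of a neighbourhood of `(𝐱_p, 0)` is a neighbourhood of `𝐱_p`. -/
lemma completion_mem_nhds {p q : ℕ} (hq : 1 ≤ q) {D : Set (Sl p)} {x : Vp p}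
    (hD : D ∈ 𝓝 ((x, 0) : Sl p)) : completion p q D ∈ 𝓝 ((x, 0) : V p q) := by
  have hcont : Continuous fun y : V p q => ((y.1, ‖y.2‖) : Sl p) := by fun_prop
  have hpre := hcont.continuousAt.preimage_mem_nhds
    (show D ∈ 𝓝 (((x, 0) : V p q).1, ‖((x, 0) : V p q).2‖) by simpa using hD)
  filter_upwards [hpre] with y hy
  refine ⟨_, hy, ?_⟩
  by_cases h : y.2 = 0
  · exact ⟨_, single_mem_S ⟨0, hq⟩, by ext1 <;> simp [spt, h]⟩
  · refine ⟨‖y.2‖⁻¹ • y.2, ?_, ?_⟩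
    · rw [mem_S_iff_norm_eq_one, norm_smul, norm_inv, norm_norm,
        inv_mul_cancel₀ (norm_ne_zero_iff.2 h)]
    · ext1
      · rfl
      · simp only [spt]
        rw [smul_inv_smul₀ (norm_ne_zero_iff.2 h)]

section Derivatives

variable {p q : ℕ} {F' : Type*} [NormedAddCommGroup F'] [NormedSpace ℝ F']

lemma eq_zero_of_self_eq_neg {a : F'} (h : a = -a) : a = 0 := by
  have h2 : (2 : ℝ) • a = 0 := by rw [two_smul, ← eq_neg_iff_add_eq_zero]; exact h
  exact (smul_eq_zero.1 h2).resolve_left two_ne_zero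

lemma fderiv_refl_of_even {D : Set (Sl p)} {x : Vp p} {F : Sl p → F'}
    (hD : D ∈ 𝓝 ((x, 0) : Sl p)) (hF : DifferentiableAt ℝ F (x, 0))
    (h : ∀ z ∈ D, F (z.1, -z.2) = F z) (w : Sl p) :
    fderiv ℝ F (x, 0) (w.1, -w.2) = fderiv ℝ F (x, 0) w := by
  have h0 : reflCLM p (x, 0) = (x, 0) := by simp [reflCLM_apply]
  have h1 : HasFDerivAt (F ∘ reflCLM p) ((fderiv ℝ F (x, 0)).comp (reflCLM p)) (x, 0) :=
    HasFDerivAt.comp _ (by rw [h0]; exact hF.hasFDerivAt) (reflCLM p).hasFDerivAt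
  have h2 : F ∘ reflCLM p =ᶠ[𝓝 ((x, 0) : Sl p)] F := by
    filter_upwards [hD] with z hz using h z hz
  exact congrArg (fun L : Sl p →L[ℝ] F' => L w)
    ((h1.congr_of_eventuallyEq h2.symm).unique hF.hasFDerivAt)

lemma fderiv_refl_of_odd {D : Set (Sl p)} {x : Vp p} {F : Sl p → F'}
    (hD : D ∈ 𝓝 ((x, 0) : Sl p)) (hF : DifferentiableAt ℝ F (x, 0))
    (h : ∀ z ∈ D, F (z.1, -z.2) = -F z) (w : Sl p) :
    fderiv ℝ F (x, 0) (w.1, -w.2) = -fderiv ℝ F (x, 0) w := by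
  have h0 : reflCLM p (x, 0) = (x, 0) := by simp [reflCLM_apply]
  have h1 : HasFDerivAt (F ∘ reflCLM p) ((fderiv ℝ F (x, 0)).comp (reflCLM p)) (x, 0) :=
    HasFDerivAt.comp _ (by rw [h0]; exact hF.hasFDerivAt) (reflCLM p).hasFDerivAt
  have h2 : F ∘ reflCLM p =ᶠ[𝓝 ((x, 0) : Sl p)] -F := by
    filter_upwards [hD] with z hz using h z hz
  exact congrArg (fun L : Sl p →L[ℝ] F' => L w)
    ((h1.congr_of_eventuallyEq h2.symm).unique hF.hasFDerivAt.neg)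

lemma pdr_eq_zero_of_even {D : Set (Sl p)} {x : Vp p} {F : Sl p → F'}
    (hD : D ∈ 𝓝 ((x, 0) : Sl p)) (hF : DifferentiableAt ℝ F (x, 0))
    (h : ∀ z ∈ D, F (z.1, -z.2) = F z) : pdr p F (x, 0) = 0 := by
  have key := fderiv_refl_of_even hD hF h (0, 1)
  rw [show ((((0, 1) : Sl p).1, -((0, 1) : Sl p).2) : Sl p) = -(0, 1) by simp, map_neg] at key
  exact eq_zero_of_self_eq_neg key.symm

lemma pdSl_eq_zero_of_odd {D : Set (Sl p)} {x : Vp p} {F : Sl p → F'}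
    (hD : D ∈ 𝓝 ((x, 0) : Sl p)) (hF : DifferentiableAt ℝ F (x, 0))
    (h : ∀ z ∈ D, F (z.1, -z.2) = -F z) (i : Fin (p + 1)) : pdSl p i F (x, 0) = 0 := by
  have key := fderiv_refl_of_odd hD hF h (Pi.single i 1, 0)
  rw [neg_zero] at key
  exact eq_zero_of_self_eq_neg key

end Derivatives

section Clifford

variable {p q : ℕ} {A : Type*} [NormedRing A] [NormedAlgebra ℝ A] (ξ : A ≃ₐ[ℝ] Cl (p + q))

lemma e_mul_self (n : ℕ) (i : Fin n) : e n i * e n i = -1 := by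
  rw [e, CliffordAlgebra.ι_sq_scalar]
  have h : Qe n (Pi.single i 1) = -1 := by
    simp [Qe, QuadraticMap.weightedSumSquares_apply, Pi.single_apply]
  rw [h, map_neg, map_one]

lemma eQ_mul_self (j : Fin q) : eQ p q ξ j * eQ p q ξ j = -1 := by
  rw [eQ, gen, ← map_mul, e_mul_self, map_neg, map_one]

lemma ωCl_single (j : Fin q) : ωCl p q ξ (EuclideanSpace.single j 1) = eQ p q ξ j := by
  simp [ωCl, ite_smul]

/-- The differential of `f = F₁ + ωF₂` along the slice in the direction `ω`. -/
lemma IsGPSlice.fderiv_spt {D : Set (Sl p)} {f : V p q → A} {F1 F2 : Sl p → A} {z : Sl p}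
    {v : Vq q} (hgs : IsGPSlice p q ξ D f F1 F2) (hv : v ∈ S q) (hD : D ∈ 𝓝 z)
    (hF1 : DifferentiableAt ℝ F1 z) (hF2 : DifferentiableAt ℝ F2 z)
    (hf : DifferentiableAt ℝ f (spt p q v z)) (w : Sl p) :
    fderiv ℝ f (spt p q v z) (spt p q v w) =
      fderiv ℝ F1 z w + ωCl p q ξ v * fderiv ℝ F2 z w := by
  have h1 : HasFDerivAt (f ∘ sptCLM p q v)
      ((fderiv ℝ f (spt p q v z)).comp (sptCLM p q v)) z :=
    HasFDerivAt.comp _ hf.hasFDerivAt (sptCLM p q v).hasFDerivAt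
  have h2 : f ∘ sptCLM p q v =ᶠ[𝓝 z] fun z => F1 z + ωCl p q ξ v * F2 z := by
    filter_upwards [hD] with z hz using hgs.2 z hz v hv
  have h3 := hF1.hasFDerivAt.add (hF2.hasFDerivAt.const_mul (ωCl p q ξ v))
  exact congrArg (fun L : Sl p →L[ℝ] A => L w)
    ((h1.congr_of_eventuallyEq h2.symm).unique h3)

end Clifford

end GPS

open GPS

/-- Remark 3.3.  If `f = F₁ + ωF₂ ∈ 𝒢𝒮¹(Ω_D)` is monogenic on `Ω_D` then at every
point `(𝐱_p, 0) ∈ D` one has `D_{𝐱_p}F₁ − q ∂_r F₂ = 0` and `D̄_{𝐱_p}F₂ + ∂_r F₁ = 0`. -/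
theorem boundary_vekua_system
    (p q : ℕ) (hq : 1 ≤ q) {A : Type*} [NormedRing A] [NormedAlgebra ℝ A]
    (ξ : A ≃ₐ[ℝ] Cl (p + q))
    (D : Set (Sl p)) (hD : IsDomain D) (hrefl : ReflInv p D)
    (f : V p q → A) (F1 F2 : Sl p → A)
    (hgs : IsGPSlice p q ξ D f F1 F2)
    (hF1 : ContDiffOn ℝ 1 F1 D) (hF2 : ContDiffOn ℝ 1 F2 D)
    (hmono : MonogenicOn p q ξ (completion p q D) f) :
    ∀ x : Vp p, ((x, 0) : Sl p) ∈ D →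
      DP p q ξ F1 (x, 0) - (q : ℝ) • pdr p F2 (x, 0) = 0 ∧
      DPbar p q ξ F2 (x, 0) + pdr p F1 (x, 0) = 0 := by
  intro x hx
  have hDx : D ∈ 𝓝 ((x, 0) : Sl p) := hD.1.mem_nhds hx
  have hd1 : DifferentiableAt ℝ F1 (x, 0) := (hF1.contDiffAt hDx).differentiableAt one_ne_zero
  have hd2 : DifferentiableAt ℝ F2 (x, 0) := (hF2.contDiffAt hDx).differentiableAt one_ne_zero
  have hΩ := completion_mem_nhds hq hDx
  have hdf : DifferentiableAt ℝ f (x, 0) :=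
    (hmono.1.contDiffAt hΩ).differentiableAt one_ne_zero
  have hr : pdr p F1 (x, 0) = 0 := pdr_eq_zero_of_even hDx hd1 fun z hz => (hgs.1 z hz).1
  have hs : ∀ i, pdSl p i F2 (x, 0) = 0 :=
    pdSl_eq_zero_of_odd hDx hd2 fun z hz => (hgs.1 z hz).2
  have hfd : ∀ v ∈ S q, ∀ w : Sl p, fderiv ℝ f (x, 0) (spt p q v w) =
      fderiv ℝ F1 (x, 0) w + ωCl p q ξ v * fderiv ℝ F2 (x, 0) w := by
    intro v hv w
    have h0 : spt p q v (x, 0) = (x, 0) := by simp [spt]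
    have key := hgs.fderiv_spt ξ hv hDx hd1 hd2 (by rwa [h0]) w
    rwa [h0] at key
  have h1 : ∀ i, pdV1 p q i f (x, 0) = pdSl p i F1 (x, 0) := by
    intro i
    have key := hfd _ (single_mem_S ⟨0, hq⟩) (Pi.single i 1, 0)
    simp only [spt, zero_smul] at key
    have hi := hs i
    rw [pdSl] at hi
    rw [pdV1, pdSl, key, hi, mul_zero, add_zero]
  have h2 : ∀ j, pdV2 p q j f (x, 0) = eQ p q ξ j * pdr p F2 (x, 0) := by
    intro j
    have key := hfd _ (single_mem_S j) (0, 1)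
    simp only [spt, one_smul, ωCl_single] at key
    have h := hr
    rw [pdr] at h
    rw [pdV2, pdr, key, h, zero_add]
  refine ⟨?_, by simp [DPbar, hs, hr]⟩
  have key := hmono.2 _ (mem_of_mem_nhds hΩ)
  simpa [DV, DP, h1, h2, ← mul_assoc, eQ_mul_self, ← sub_eq_add_neg,
    ← Nat.cast_smul_eq_nsmul ℝ] using key
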